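/- Fix p ∈ (0,1) and for each n let ξ_{ij} (1 ≤ i,j ≤ n) be i.i.d. Bernoulli(p). Define Ĥ_n := ∏_{i=1}^n (∑_{j=1}^n ξ_{ij})/(np). Then ln(Ĥ_n) converges weakly as n → ∞ to N(-(1-p)/(2p), (1-p)/p); equivalently, Ĥ_n converges weakly to the lognormal distribution with parameters μ = -(1-p)/(2p) and σ² = (1-p)/p. -/

import Mathlib

open MeasureTheory Filter ProbabilityTheory

open scoped Topology

/-- Expectation of `g` at the sum of `n` i.i.d. centred Bernoulli(`p`) variables. -/
noncomputable def centredBinomialExp {V : Type*} [AddCommGroup V] [Module ℝ V] (p : ℝ) (n : ℕ)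
    (g : ℝ → V) : V :=
  ∑ x : Fin n → Bool, (∏ j, if x j then p else 1 - p) • g (∑ j, if x j then 1 - p else -p)

section Moments

variable {V : Type*} [AddCommGroup V] [Module ℝ V] (p : ℝ) (n : ℕ)

lemma centredBinomialExp_zero (g : ℝ → V) : centredBinomialExp p 0 g = g 0 := by
  simp [centredBinomialExp]

lemma centredBinomialExp_succ (g : ℝ → V) :
    centredBinomialExp p (n + 1) g =
      p • centredBinomialExp p n (fun s ↦ g (1 - p + s)) +
        (1 - p) • centredBinomialExp p n (fun s ↦ g (-p + s)) := by
  unfold centredBinomialExp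
  rw [← (Fin.consEquiv fun _ : Fin (n + 1) ↦ Bool).sum_comp, Fintype.sum_prod_type,
    Fintype.sum_bool]
  simp [Fin.consEquiv, Fin.prod_univ_succ, Fin.sum_univ_succ, Finset.smul_sum, mul_smul]

lemma centredBinomialExp_add (g h : ℝ → V) :
    centredBinomialExp p n (fun s ↦ g s + h s) =
      centredBinomialExp p n g + centredBinomialExp p n h := by
  simp [centredBinomialExp, Finset.sum_add_distrib]

lemma centredBinomialExp_sub (g h : ℝ → V) :
    centredBinomialExp p n (fun s ↦ g s - h s) =
      centredBinomialExp p n g - centredBinomialExp p n h := by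
  simp [centredBinomialExp, Finset.sum_sub_distrib, smul_sub]

lemma centredBinomialExp_smul_const (g : ℝ → ℝ) (v : V) :
    centredBinomialExp p n (fun s ↦ g s • v) = centredBinomialExp p n g • v := by
  simp [centredBinomialExp, Finset.sum_smul, mul_smul]

lemma centredBinomialExp_const_mul (c : ℝ) (g : ℝ → ℝ) :
    centredBinomialExp p n (fun s ↦ c * g s) = c * centredBinomialExp p n g := by
  simp only [centredBinomialExp, Finset.mul_sum, smul_eq_mul]
  exact Finset.sum_congr rfl fun _ _ ↦ by ring

lemma centredBinomialExp_one : centredBinomialExp p n (fun _ ↦ (1 : ℝ)) = 1 := by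
  induction n with
  | zero => simp [centredBinomialExp_zero]
  | succ n ih => rw [centredBinomialExp_succ, ih]; simp

lemma centredBinomialExp_id : centredBinomialExp p n (fun s ↦ s) = 0 := by
  induction n with
  | zero => simp [centredBinomialExp_zero]
  | succ n ih =>
    have h (a : ℝ) : centredBinomialExp p n (fun s ↦ a + s) = a := by
      have := centredBinomialExp_add p n (fun _ ↦ a * 1) fun s ↦ s
      rw [centredBinomialExp_const_mul, centredBinomialExp_one, ih] at this
      simpa using this
    rw [centredBinomialExp_succ, h, h, smul_eq_mul, smul_eq_mul]
    ring

lemma centredBinomialExp_sq : centredBinomialExp p n (fun s ↦ s ^ 2) = n * (p * (1 - p)) := by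
  induction n with
  | zero => simp [centredBinomialExp_zero]
  | succ n ih =>
    have h (a : ℝ) :
        centredBinomialExp p n (fun s ↦ (a + s) ^ 2) = a ^ 2 + n * (p * (1 - p)) := by
      have e (s : ℝ) : (a + s) ^ 2 = a ^ 2 * 1 + 2 * a * s + s ^ 2 := by ring
      simp_rw [e]
      rw [centredBinomialExp_add, centredBinomialExp_add, centredBinomialExp_const_mul,
        centredBinomialExp_const_mul, centredBinomialExp_one, centredBinomialExp_id, ih]
      ring
    rw [centredBinomialExp_succ, h, h, smul_eq_mul, smul_eq_mul]
    push_cast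
    ring

variable {p}

lemma centredBinomialExp_pow_four_le (hp : p ∈ Set.Icc (0 : ℝ) 1) :
    centredBinomialExp p n (fun s ↦ s ^ 4) ≤ 3 * (n : ℝ) ^ 2 := by
  induction n with
  | zero => simp [centredBinomialExp_zero]
  | succ n ih =>
    have h (a : ℝ) : centredBinomialExp p n (fun s ↦ (a + s) ^ 4) =
        a ^ 4 + 6 * a ^ 2 * (n * (p * (1 - p))) + 4 * a * centredBinomialExp p n (fun s ↦ s ^ 3)
          + centredBinomialExp p n (fun s ↦ s ^ 4) := by
      have e (s : ℝ) : (a + s) ^ 4 =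
          a ^ 4 * 1 + 4 * a ^ 3 * s + 6 * a ^ 2 * s ^ 2 + 4 * a * s ^ 3 + s ^ 4 := by ring
      simp_rw [e]
      simp only [centredBinomialExp_add, centredBinomialExp_const_mul, centredBinomialExp_one,
        centredBinomialExp_sq]
      rw [centredBinomialExp_const_mul p n (4 * a ^ 3) fun s ↦ s, centredBinomialExp_id]
      ring
    rw [centredBinomialExp_succ, h, h, smul_eq_mul, smul_eq_mul]
    obtain ⟨h0, h1⟩ := hp
    have hv0 : 0 ≤ p * (1 - p) := mul_nonneg h0 (by linarith)
    have hv : p * (1 - p) ≤ 1 / 4 := by nlinarith [sq_nonneg (p - 1 / 2)]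
    have hv2 : (p * (1 - p)) ^ 2 ≤ 1 / 16 := by nlinarith
    have h4 : p * (1 - p) * ((1 - p) ^ 3 + p ^ 3) ≤ 1 := by
      have : (1 - p) ^ 3 + p ^ 3 = 1 - 3 * (p * (1 - p)) := by ring
      rw [this]; nlinarith
    have hn := mul_le_mul_of_nonneg_left hv2 (Nat.cast_nonneg (α := ℝ) n)
    push_cast
    nlinarith [Nat.cast_nonneg (α := ℝ) n]

lemma centredBinomialExp_mono (hp : p ∈ Set.Icc (0 : ℝ) 1) {g h : ℝ → ℝ} (hgh : ∀ s, g s ≤ h s) :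
    centredBinomialExp p n g ≤ centredBinomialExp p n h := by
  refine Finset.sum_le_sum fun x _ ↦ mul_le_mul_of_nonneg_left (hgh _) ?_
  refine Finset.prod_nonneg fun j _ ↦ ?_
  split_ifs <;> linarith [hp.1, hp.2]

lemma norm_centredBinomialExp_le {V : Type*} [NormedAddCommGroup V] [NormedSpace ℝ V]
    (hp : p ∈ Set.Icc (0 : ℝ) 1) (g : ℝ → V) :
    ‖centredBinomialExp p n g‖ ≤ centredBinomialExp p n (fun s ↦ ‖g s‖) := by
  refine (norm_sum_le _ _).trans (Finset.sum_le_sum fun x _ ↦ ?_)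
  rw [norm_smul, Real.norm_of_nonneg, smul_eq_mul]
  refine Finset.prod_nonneg fun j _ ↦ ?_
  split_ifs <;> linarith [hp.1, hp.2]

end Moments

/-- The function `r ↦ exp (i t log r)`, set to `0` at `r = 0` so that it is multiplicative. -/
noncomputable def expLogHom (t : ℝ) : ℝ →* ℂ where
  toFun r := if r = 0 then 0 else Complex.exp ((t * Real.log r : ℝ) * Complex.I)
  map_one' := by simp
  map_mul' x y := by
    by_cases hx : x = 0
    · simp [hx]
    by_cases hy : y = 0
    · simp [hy]
    simp only [hx, hy, mul_eq_zero, or_self, if_false, Real.log_mul hx hy, ← Complex.exp_add]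
    push_cast
    ring_nf

lemma expLogHom_apply (t r : ℝ) : expLogHom t r =
    if r = 0 then 0 else Complex.exp ((t * Real.log r : ℝ) * Complex.I) := rfl

lemma norm_expLogHom_le (t r : ℝ) : ‖expLogHom t r‖ ≤ 1 := by
  rw [expLogHom_apply]
  split_ifs
  · simp
  · rw [Complex.norm_exp_ofReal_mul_I]

lemma log_one_add_isBigO :
    (fun z : ℝ ↦ Real.log (1 + z) - (z - z ^ 2 / 2)) =O[𝓝 0] fun z ↦ z ^ 3 := by
  refine .of_bound 2 ?_
  filter_upwards [Metric.ball_mem_nhds (0 : ℝ) (ε := 1 / 2) (by norm_num)] with z hz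
  rw [mem_ball_zero_iff, Real.norm_eq_abs] at hz
  have h := Real.abs_log_sub_add_sum_range_le (x := -z) (by rw [abs_neg]; linarith) 2
  simp only [Finset.sum_range_succ, Finset.sum_range_zero, abs_neg, sub_neg_eq_add] at h
  rw [Real.norm_eq_abs, Real.norm_eq_abs, abs_pow]
  calc _ = _ := by congr 1; norm_num; ring
    _ ≤ _ := h
    _ ≤ 2 * |z| ^ 3 := by
      rw [div_le_iff₀ (by linarith)]
      norm_num only
      nlinarith [pow_nonneg (abs_nonneg z) 3]

lemma expLogHom_one_add_isBigO (t : ℝ) :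
    (fun z : ℝ ↦ expLogHom t (1 + z) -
      (1 + z • (t * Complex.I) + z ^ 2 • (-(t * Complex.I + t ^ 2) / 2))) =O[𝓝 0]
        fun z ↦ z ^ 3 := by
  have hL := log_one_add_isBigO
  have h32 : (fun z : ℝ ↦ z ^ 3) =O[𝓝 0] fun z ↦ z ^ 2 :=
    (Asymptotics.isLittleO_pow_pow (by norm_num)).isBigO
  have h21 : (fun z : ℝ ↦ z ^ 2) =O[𝓝 0] fun z ↦ z := by
    simpa using (Asymptotics.isLittleO_pow_pow (𝕜 := ℝ) (m := 1) (n := 2) (by norm_num)).isBigO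
  have hL2 : (fun z : ℝ ↦ Real.log (1 + z) - z) =O[𝓝 0] fun z ↦ z ^ 2 := by
    have := (hL.trans h32).sub ((Asymptotics.isBigO_refl (fun z : ℝ ↦ z ^ 2) _).const_mul_left
      (1 / 2))
    exact this.congr_left fun z ↦ by ring
  have hL1 : (fun z : ℝ ↦ Real.log (1 + z)) =O[𝓝 0] fun z ↦ z :=
    ((hL2.trans h21).add (Asymptotics.isBigO_refl _ _)).congr_left fun z ↦ by ring
  have hLsq : (fun z : ℝ ↦ Real.log (1 + z) ^ 2 - z ^ 2) =O[𝓝 0] fun z ↦ z ^ 3 :=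
    (hL2.mul (hL1.add (Asymptotics.isBigO_refl _ _))).congr (fun z ↦ by ring) fun z ↦ by ring
  have hexp : (fun z : ℝ ↦ Complex.exp ((t * Real.log (1 + z) : ℝ) * Complex.I) -
      ∑ i ∈ Finset.range 3, ((t * Real.log (1 + z) : ℝ) * Complex.I) ^ i / i.factorial)
        =O[𝓝 0] fun z ↦ z ^ 3 := by
    have hcont : ContinuousAt (fun z : ℝ ↦ ((t * Real.log (1 + z) : ℝ) * Complex.I)) 0 := by
      have : ContinuousAt (fun z : ℝ ↦ Real.log (1 + z)) 0 :=
        ContinuousAt.log (by fun_prop) (by norm_num)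
      fun_prop
    have ht : Tendsto (fun z : ℝ ↦ ((t * Real.log (1 + z) : ℝ) * Complex.I)) (𝓝 0) (𝓝 0) := by
      simpa using hcont.tendsto
    refine ((Complex.exp_sub_sum_range_isBigO_pow 3).comp_tendsto ht).trans ?_
    refine Asymptotics.IsBigO.pow (.trans ?_ hL1) 3
    refine .of_bound |t| (.of_forall fun z ↦ ?_)
    simp
  have hne : ∀ᶠ z : ℝ in 𝓝 0, 1 + z ≠ 0 :=
    (by fun_prop : ContinuousAt (fun z : ℝ ↦ 1 + z) 0).eventually_ne (by norm_num)
  have hLc := (Complex.ofRealCLM.isBigO_comp (fun z : ℝ ↦ Real.log (1 + z) - (z - z ^ 2 / 2))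
    (𝓝 0)).trans hL
  have hLsqc := (Complex.ofRealCLM.isBigO_comp (fun z : ℝ ↦ Real.log (1 + z) ^ 2 - z ^ 2)
    (𝓝 0)).trans hLsq
  refine ((hexp.add (hLc.const_mul_left (t * Complex.I))).add
    (hLsqc.const_mul_left (-t ^ 2 / 2))).congr' ?_ .rfl
  filter_upwards [hne] with z hz
  simp only [expLogHom_apply, hz, if_false, Finset.sum_range_succ, Finset.sum_range_zero,
    Complex.ofRealCLM_apply, Nat.factorial, Complex.real_smul]
  push_cast
  simp only [mul_pow, Complex.I_sq]
  ring

lemma exists_norm_expLogHom_one_add_sub_le (t : ℝ) {ε : ℝ} (hε : 0 < ε) :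
    ∃ C, ∀ z : ℝ, ‖expLogHom t (1 + z) -
      (1 + z • (t * Complex.I) + z ^ 2 • (-(t * Complex.I + t ^ 2) / 2))‖
        ≤ ε * z ^ 2 + C * z ^ 4 := by
  have h := (expLogHom_one_add_isBigO t).trans_isLittleO
    (Asymptotics.isLittleO_pow_pow (𝕜 := ℝ) (m := 2) (n := 3) (by norm_num))
  obtain ⟨δ, hδ, hb⟩ := Metric.eventually_nhds_iff.1 (h.bound hε)
  set a : ℂ := t * Complex.I
  set b : ℂ := -(t * Complex.I + t ^ 2) / 2
  refine ⟨2 / δ ^ 4 + ‖a‖ / δ ^ 3 + ‖b‖ / δ ^ 2, fun z ↦ ?_⟩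
  have hC : 0 ≤ 2 / δ ^ 4 + ‖a‖ / δ ^ 3 + ‖b‖ / δ ^ 2 := by positivity
  by_cases hz : |z| < δ
  · have := hb (y := z) (by simpa using hz)
    rw [Real.norm_of_nonneg (by positivity)] at this
    nlinarith [mul_nonneg hC (by positivity : 0 ≤ z ^ 4)]
  · have hz1 : 1 ≤ |z| / δ := by rw [le_div_iff₀ hδ]; linarith
    have h1 : ‖expLogHom t (1 + z) - (1 + z • a + z ^ 2 • b)‖ ≤
        2 + |z| * ‖a‖ + |z| ^ 2 * ‖b‖ := by
      have e1 := norm_sub_le (expLogHom t (1 + z)) (1 + z • a + z ^ 2 • b)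
      have e2 := norm_add₃_le (a := (1 : ℂ)) (b := z • a) (c := z ^ 2 • b)
      rw [norm_smul, norm_smul, norm_pow, Real.norm_eq_abs, norm_one] at e2
      linarith [norm_expLogHom_le t (1 + z)]
    have h2 : 2 + |z| * ‖a‖ + |z| ^ 2 * ‖b‖ ≤
        2 * (|z| / δ) ^ 4 + |z| * ‖a‖ * (|z| / δ) ^ 3 + |z| ^ 2 * ‖b‖ * (|z| / δ) ^ 2 := by
      refine add_le_add (add_le_add ?_ ?_) ?_ <;>
        exact le_mul_of_one_le_right (by positivity) (one_le_pow₀ hz1)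
    have h3 : 2 * (|z| / δ) ^ 4 + |z| * ‖a‖ * (|z| / δ) ^ 3 + |z| ^ 2 * ‖b‖ * (|z| / δ) ^ 2 =
        (2 / δ ^ 4 + ‖a‖ / δ ^ 3 + ‖b‖ / δ ^ 2) * z ^ 4 := by
      rw [← (by decide : Even 4).pow_abs z]
      field_simp
    nlinarith [mul_nonneg hε.le (sq_nonneg z)]

lemma tendsto_centredBinomialExp_expLogHom_pow {p : ℝ} (hp : p ∈ Set.Ioo (0 : ℝ) 1) (t : ℝ) :
    Tendsto (fun n : ℕ ↦
        (centredBinomialExp p n fun s ↦ expLogHom t (1 + (n * p)⁻¹ * s)) ^ n) atTop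
      (𝓝 (Complex.exp ((((1 - p) / p : ℝ) : ℂ) * (-(t * Complex.I + t ^ 2) / 2)))) := by
  have hp' : p ∈ Set.Icc (0 : ℝ) 1 := ⟨hp.1.le, hp.2.le⟩
  have hp0 := hp.1
  apply Complex.tendsto_pow_exp_of_isLittleO_sub_add_div
  set a : ℂ := t * Complex.I
  set b : ℂ := -(t * Complex.I + t ^ 2) / 2
  set v := (1 - p) / p
  have hv : 0 < v := div_pos (by linarith [hp.2]) hp0
  refine Asymptotics.isLittleO_iff.2 fun c hc ↦ ?_
  obtain ⟨C, hC⟩ := exists_norm_expLogHom_one_add_sub_le t (ε := c / (2 * v)) (by positivity)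
  have hlim : Tendsto (fun n : ℕ ↦ |C| * 3 / p ^ 4 / (n : ℝ)) atTop (𝓝 0) :=
    tendsto_const_div_atTop_nhds_zero_nat _
  filter_upwards [hlim.eventually_lt_const (half_pos hc), eventually_gt_atTop 0] with n hn hn0
  have hn0' : (0 : ℝ) < n := by exact_mod_cast hn0
  set k : ℝ := (n * p)⁻¹ with hk
  have hmain : centredBinomialExp p n (fun s ↦ 1 + (k * s) • a + (k * s) ^ 2 • b) =
      1 + v * b / n := by
    have e : (fun s : ℝ ↦ 1 + (k * s) • a + (k * s) ^ 2 • b) =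
        fun s : ℝ ↦ (1 : ℝ) • (1 : ℂ) + (k * s) • a + (k ^ 2 * s ^ 2) • b := by
      ext s; rw [one_smul, mul_pow]
    rw [e, centredBinomialExp_add, centredBinomialExp_add, centredBinomialExp_smul_const,
      centredBinomialExp_smul_const, centredBinomialExp_smul_const, centredBinomialExp_const_mul,
      centredBinomialExp_const_mul, centredBinomialExp_one, centredBinomialExp_id,
      centredBinomialExp_sq]
    have : k ^ 2 * (n * (p * (1 - p))) = v / n := by rw [hk]; simp only [v]; field_simp
    rw [this]
    simp only [one_smul, mul_zero, zero_smul, add_zero, Complex.real_smul]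
    push_cast
    ring
  rw [← hmain, ← centredBinomialExp_sub]
  refine (norm_centredBinomialExp_le n hp' _).trans ?_
  refine (centredBinomialExp_mono n hp' (h := fun s ↦
    c / (2 * v) * k ^ 2 * s ^ 2 + |C| * k ^ 4 * s ^ 4) fun s ↦ ?_).trans ?_
  · refine (hC (k * s)).trans ?_
    rw [mul_pow, mul_pow, ← mul_assoc, ← mul_assoc]
    gcongr
    exact le_abs_self C
  · rw [centredBinomialExp_add, centredBinomialExp_const_mul, centredBinomialExp_const_mul,
      centredBinomialExp_sq]
    have h4 := mul_le_mul_of_nonneg_left (centredBinomialExp_pow_four_le n hp')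
      (by positivity : 0 ≤ |C| * k ^ 4)
    have e2 : c / (2 * v) * k ^ 2 * (n * (p * (1 - p))) = c / 2 / n := by
      have : 1 - p ≠ 0 := by linarith [hp.2]
      rw [hk]; simp only [v]; field_simp
    have e4 : |C| * k ^ 4 * (3 * (n : ℝ) ^ 2) = |C| * 3 / p ^ 4 / n / n := by
      rw [hk]; field_simp
    have h5 : |C| * 3 / p ^ 4 / n / n ≤ c / 2 / n := by gcongr
    have e5 : ‖1 / (n : ℂ)‖ = 1 / n := by simp
    rw [e5, e2]
    have : c * (1 / n) = c / 2 / n + c / 2 / n := by ring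
    linarith

section DiscreteLaw

variable {ι : Type*} [Fintype ι]

/-- The law of `Y` under the weights `w` on a finite type. -/
noncomputable def weightedLaw (w Y : ι → ℝ) : Measure ℝ :=
  ∑ i, ENNReal.ofReal (w i) • Measure.dirac (Y i)

lemma isProbabilityMeasure_weightedLaw {w : ι → ℝ} (hw : ∀ i, 0 ≤ w i) (hw1 : ∑ i, w i = 1)
    (Y : ι → ℝ) : IsProbabilityMeasure (weightedLaw w Y) := by
  constructor
  simp [weightedLaw, ← ENNReal.ofReal_sum_of_nonneg fun i _ ↦ hw i, hw1]

lemma integral_weightedLaw {V : Type*} [NormedAddCommGroup V] [NormedSpace ℝ V] [CompleteSpace V]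
    {w : ι → ℝ} (hw : ∀ i, 0 ≤ w i) (Y : ι → ℝ) (f : ℝ → V) :
    ∫ x, f x ∂(weightedLaw w Y) = ∑ i, w i • f (Y i) := by
  rw [weightedLaw, integral_finsetSum_measure]
  · simp [integral_smul_measure, hw]
  · exact fun i _ ↦ (integrable_dirac (by simp)).smul_measure ENNReal.ofReal_ne_top

/-- The characteristic function of `log R` differs from the expectation of `expLogHom t R` by at
most the probability that `R = 0`. -/
lemma norm_charFun_weightedLaw_log_sub_le {w : ι → ℝ} (hw : ∀ i, 0 ≤ w i) (hw1 : ∑ i, w i = 1)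
    (R : ι → ℝ) (t : ℝ) :
    ‖charFun (weightedLaw w fun i ↦ Real.log (R i)) t - ∑ i, w i • expLogHom t (R i)‖ ≤
      ‖∑ i, w i • expLogHom 0 (R i) - 1‖ := by
  have h0 : ∑ i, w i • expLogHom 0 (R i) - 1 =
      ((-∑ i, w i * (if R i = 0 then 1 else 0) : ℝ) : ℂ) := by
    have : (1 : ℂ) = ∑ i, (w i : ℂ) := by exact_mod_cast hw1.symm
    rw [this, ← Finset.sum_sub_distrib, ← Finset.sum_neg_distrib]
    push_cast
    refine Finset.sum_congr rfl fun i _ ↦ ?_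
    by_cases h : R i = 0 <;> simp [expLogHom_apply, h]
  rw [h0, Complex.norm_real, norm_neg, Real.norm_of_nonneg
    (Finset.sum_nonneg fun i _ ↦ mul_nonneg (hw i) (by split_ifs <;> norm_num)),
    charFun_apply_real, integral_weightedLaw hw, ← Finset.sum_sub_distrib]
  refine (norm_sum_le _ _).trans (Finset.sum_le_sum fun i _ ↦ ?_)
  rw [← smul_sub, norm_smul, Real.norm_of_nonneg (hw i)]
  refine mul_le_mul_of_nonneg_left ?_ (hw i)
  by_cases h : R i = 0 <;> simp [expLogHom_apply, h]

end DiscreteLaw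

/-- The probability of an outcome of a matrix of i.i.d. Bernoulli(`p`) entries. -/
noncomputable def bernoulliWeight (p : ℝ) {n : ℕ} (ξ : Fin n → Fin n → Bool) : ℝ :=
  ∏ i, ∏ j, (if ξ i j then p else 1 - p)

/-- The product of the normalised row sums of a Boolean matrix. -/
noncomputable def rowSumProd (p : ℝ) {n : ℕ} (ξ : Fin n → Fin n → Bool) : ℝ :=
  ∏ i, (∑ j, (if ξ i j then (1 : ℝ) else 0)) / ((n : ℝ) * p)

lemma bernoulliWeight_nonneg {p : ℝ} (hp : p ∈ Set.Icc (0 : ℝ) 1) {n : ℕ}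
    (ξ : Fin n → Fin n → Bool) : 0 ≤ bernoulliWeight p ξ := by
  refine Finset.prod_nonneg fun i _ ↦ Finset.prod_nonneg fun j _ ↦ ?_
  split_ifs <;> linarith [hp.1, hp.2]

lemma sum_bernoulliWeight (p : ℝ) (n : ℕ) :
    ∑ ξ : Fin n → Fin n → Bool, bernoulliWeight p ξ = 1 := by
  have h := centredBinomialExp_one p n
  simp only [centredBinomialExp, smul_eq_mul, mul_one] at h
  have := Fintype.prod_sum fun (_ : Fin n) (x : Fin n → Bool) ↦ ∏ j, if x j then p else 1 - p
  simp only [h, Finset.prod_const_one] at this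
  exact this.symm

lemma sum_bernoulliWeight_smul_expLogHom {p : ℝ} (hp : p ≠ 0) (n : ℕ) (t : ℝ) :
    ∑ ξ : Fin n → Fin n → Bool, bernoulliWeight p ξ • expLogHom t (rowSumProd p ξ) =
      (centredBinomialExp p n fun s ↦ expLogHom t (1 + (n * p)⁻¹ * s)) ^ n := by
  have hrow (x : Fin n → Bool) (i : Fin n) :
      (∑ j, (if x j then (1 : ℝ) else 0)) / ((n : ℝ) * p) =
        1 + (n * p)⁻¹ * ∑ j, if x j then 1 - p else -p := by
    have hn : (n : ℝ) ≠ 0 := by exact_mod_cast (i.pos).ne'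
    have e (j : Fin n) :
        (if x j then 1 - p else -p) = (if x j then (1 : ℝ) else 0) - p := by
      split_ifs <;> ring
    simp_rw [e, Finset.sum_sub_distrib]
    simp only [Finset.sum_const, Finset.card_univ, Fintype.card_fin, nsmul_eq_mul]
    field_simp
    ring
  have h := Fintype.prod_sum fun (_ : Fin n) (x : Fin n → Bool) ↦
    (∏ j, if x j then p else 1 - p) • expLogHom t (1 + (n * p)⁻¹ * ∑ j, if x j then 1 - p else -p)
  rw [Finset.prod_const, Finset.card_univ, Fintype.card_fin] at h
  rw [centredBinomialExp, h]
  refine Finset.sum_congr rfl fun ξ _ ↦ ?_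
  rw [bernoulliWeight, rowSumProd, map_prod]
  simp only [Complex.real_smul, Finset.prod_mul_distrib, Complex.ofReal_prod]
  exact congrArg _ (Finset.prod_congr rfl fun i _ ↦ by rw [hrow (ξ i) i])

lemma tendsto_charFun_log_rowSumProd {p : ℝ} (hp : p ∈ Set.Ioo (0 : ℝ) 1) (t : ℝ) :
    Tendsto (fun n : ℕ ↦ charFun (weightedLaw (bernoulliWeight p (n := n))
        fun ξ ↦ Real.log (rowSumProd p ξ)) t) atTop
      (𝓝 (charFun (gaussianReal (-(1 - p) / (2 * p)) (Real.toNNReal ((1 - p) / p))) t)) := by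
  have hlim (t : ℝ) := (tendsto_centredBinomialExp_expLogHom_pow hp t).congr fun n ↦
    (sum_bernoulliWeight_smul_expLogHom hp.1.ne' n t).symm
  have hzero := (tendsto_sub_nhds_zero_iff.2 (hlim 0)).norm
  simp only [Complex.ofReal_zero, zero_mul, zero_pow two_ne_zero, add_zero, neg_zero, zero_div,
    mul_zero, Complex.exp_zero, norm_zero] at hzero
  have hdiff := squeeze_zero_norm (fun n ↦ norm_charFun_weightedLaw_log_sub_le
    (bernoulliWeight_nonneg ⟨hp.1.le, hp.2.le⟩) (sum_bernoulliWeight p n)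
    (rowSumProd p) t) hzero
  have hsum := hdiff.add (hlim t)
  simp only [sub_add_cancel, zero_add] at hsum
  convert hsum using 2
  have hv : 0 ≤ (1 - p) / p := div_nonneg (by linarith [hp.2]) hp.1.le
  have hp0 : (p : ℂ) ≠ 0 := by exact_mod_cast hp.1.ne'
  rw [charFun_gaussianReal, Real.coe_toNNReal _ hv]
  push_cast
  congr 1
  field_simp
  ring

/-- Fix `p ∈ (0,1)` and for each `n` let `ξ_{ij}` (`1 ≤ i,j ≤ n`) be i.i.d. Bernoulli(p).
Define `Ĥ_n := ∏_i (∑_j ξ_{ij})/(np)`. Then `ln(Ĥ_n)` converges weakly as `n → ∞` to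
`N(-(1-p)/(2p), (1-p)/p)`; weak convergence is tested against bounded continuous functions,
the expectation being a sum over all outcomes `ξ` weighted by the product of Bernoulli
probabilities. -/
theorem stmt_16 (p : ℝ) (hp : p ∈ Set.Ioo (0 : ℝ) 1) :
    ∀ f : BoundedContinuousFunction ℝ ℝ,
      Tendsto (fun n : ℕ =>
          ∑ ξ : Fin n → Fin n → Bool,
            (∏ i, ∏ j, (if ξ i j then p else 1 - p)) *
              f (Real.log (∏ i, (∑ j, (if ξ i j then (1 : ℝ) else 0)) / ((n : ℝ) * p))))
        atTop
        (nhds (∫ x, f x ∂(gaussianReal (-(1 - p) / (2 * p))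
          (Real.toNNReal ((1 - p) / p))))) := by
  intro f
  have hw {n : ℕ} (ξ : Fin n → Fin n → Bool) : 0 ≤ bernoulliWeight p ξ :=
    bernoulliWeight_nonneg ⟨hp.1.le, hp.2.le⟩ ξ
  let μ (n : ℕ) : ProbabilityMeasure ℝ :=
    ⟨weightedLaw (bernoulliWeight p (n := n)) fun ξ ↦ Real.log (rowSumProd p ξ),
      isProbabilityMeasure_weightedLaw hw (sum_bernoulliWeight p n) _⟩
  let ν : ProbabilityMeasure ℝ :=
    ⟨gaussianReal (-(1 - p) / (2 * p)) (Real.toNNReal ((1 - p) / p)), inferInstance⟩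
  have hμν : Tendsto μ atTop (𝓝 ν) :=
    ProbabilityMeasure.tendsto_iff_tendsto_charFun.2 (tendsto_charFun_log_rowSumProd hp)
  refine (ProbabilityMeasure.tendsto_iff_forall_integral_tendsto.1 hμν f).congr fun n ↦ ?_
  exact integral_weightedLaw hw _ f
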